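/- For every m ≥ 8, the weight spectrum of RM(m-4,m) equals {0, 16, 24} ∪ {28, 30, 32, …, 2^m−28, i.e. all even integers from 28 to 2^m−28} ∪ {2^m−24, 2^m−16, 2^m}. -/

import Mathlib

open MvPolynomial Pointwise

/-- The binary Reed-Muller code of order `r` in `m` variables, viewed as the set of
Boolean functions represented by polynomials of total degree at most `r`. -/
def RM (r m : ℕ) : Set ((Fin m → ZMod 2) → ZMod 2) :=
  {f | ∃ p : MvPolynomial (Fin m) (ZMod 2), p.totalDegree ≤ r ∧ ∀ x, eval x p = f x}

/-- Hamming weight of a Boolean function: number of inputs where it is nonzero. -/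
def wt {m : ℕ} (f : (Fin m → ZMod 2) → ZMod 2) : ℕ :=
  Fintype.card {x // f x ≠ 0}

/-- Weight spectrum of `RM(r,m)`. -/
def spec (r m : ℕ) : Set ℕ := {w | ∃ f ∈ RM r m, wt f = w}

/-! ### Lower bounds on weights -/

theorem zmod2_cases (a : ZMod 2) : a = 0 ∨ a = 1 := by revert a; decide

/-- The part of `S` on the affine hyperplane `u ⬝ x = c`. -/
def side {m : ℕ} (S : Finset (Fin m → ZMod 2)) (u : Fin m → ZMod 2) (c : ZMod 2) :
    Finset (Fin m → ZMod 2) := S.filter (fun x => u ⬝ᵥ x = c)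

theorem side_add {m : ℕ} (S : Finset (Fin m → ZMod 2)) (u : Fin m → ZMod 2) (c : ZMod 2) :
    (side S u c).card + (side S u (c + 1)).card = S.card := by
  have h : side S u (c + 1) = S.filter (fun x => ¬ (u ⬝ᵥ x = c)) := by
    unfold side
    apply Finset.filter_congr
    intro x _
    generalize u ⬝ᵥ x = t
    revert t c; decide
  rw [h]
  exact Finset.card_filter_add_card_filter_not _

theorem card_dot_zero {m : ℕ} (y : Fin m → ZMod 2) (hy : y ≠ 0) :
    2 * (Finset.univ.filter (fun u : Fin m → ZMod 2 => u ⬝ᵥ y = 0)).card = 2 ^ m := by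
  obtain ⟨i, hi⟩ : ∃ i, y i ≠ 0 := by
    by_contra! h
    exact hy (funext h)
  have hi : y i = 1 := (zmod2_cases (y i)).resolve_left hi
  have h1 : (Finset.univ.filter (fun u : Fin m → ZMod 2 => u ⬝ᵥ y = 0)).card
      = (Finset.univ.filter (fun u : Fin m → ZMod 2 => ¬ u ⬝ᵥ y = 0)).card := by
    have key : ∀ u : Fin m → ZMod 2, (u + Pi.single i 1) ⬝ᵥ y = u ⬝ᵥ y + 1 := by
      intro u
      rw [add_dotProduct, single_dotProduct, hi, mul_one]
    have h2 : ∀ u : Fin m → ZMod 2, u + Pi.single i 1 + Pi.single i 1 = u := by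
      intro u
      funext j
      simp only [Pi.add_apply]
      rw [add_assoc, CharTwo.add_self_eq_zero, add_zero]
    refine Finset.card_bij' (fun u _ => u + Pi.single i 1) (fun u _ => u + Pi.single i 1)
      ?_ ?_ (fun u _ => h2 u) (fun u _ => h2 u)
    · intro u hu
      simp only [Finset.mem_filter, Finset.mem_univ, true_and] at hu ⊢
      rw [key, hu]; decide
    · intro u hu
      simp only [Finset.mem_filter, Finset.mem_univ, true_and] at hu ⊢
      rw [key, (zmod2_cases _).resolve_left hu]; decide
  have h3 := Finset.card_filter_add_card_filter_not (s := (Finset.univ : Finset (Fin m → ZMod 2)))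
    (fun u : Fin m → ZMod 2 => u ⬝ᵥ y = 0)
  have h4 : (Finset.univ : Finset (Fin m → ZMod 2)).card = 2 ^ m := by simp
  omega

theorem additive_eq_dot {m : ℕ} (h : (Fin m → ZMod 2) → ZMod 2)
    (hadd : ∀ u v, h (u + v) = h u + h v) : ∃ a, ∀ u, h u = u ⬝ᵥ a := by
  let L : (Fin m → ZMod 2) →ₗ[ZMod 2] ZMod 2 :=
    AddMonoidHom.toZModLinearMap 2 (AddMonoidHom.mk' h hadd)
  refine ⟨fun i => L (fun j => if i = j then 1 else 0), fun u => ?_⟩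
  have := LinearMap.pi_apply_eq_sum_univ L u
  simp only [smul_eq_mul] at this
  exact this

/-- If each hyperplane has a strictly heavy side, and heavy sides are compatible with addition,
we get a contradiction. -/
theorem key {m : ℕ} (S : Finset (Fin m → ZMod 2)) (hS : Even S.card)
    (tie : ∀ u, 2 * (side S u 0).card ≠ S.card)
    (tri : ∀ u v c d, 2 * (side S u c).card < S.card → 2 * (side S v d).card < S.card →
      2 * (side S (u + v) (c + d)).card < S.card → False) : False := by
  obtain ⟨h, hh⟩ : ∃ h : (Fin m → ZMod 2) → ZMod 2,
      ∀ u, 2 * (side S u (h u + 1)).card < S.card := by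
    have : ∀ u, ∃ c : ZMod 2, 2 * (side S u (c + 1)).card < S.card := by
      intro u
      have h1 := side_add S u 0
      have h2 := tie u
      rcases lt_or_gt_of_ne h2 with h3 | h3
      · exact ⟨1, by simpa [show (1 + 1 : ZMod 2) = 0 from by decide] using h3⟩
      · exact ⟨0, by omega⟩
    exact ⟨fun u => (this u).choose, fun u => (this u).choose_spec⟩
  have hadd : ∀ u v, h (u + v) = h u + h v := by
    intro u v
    by_contra hne
    refine tri u v (h u + 1) (h v + 1) (hh u) (hh v) ?_
    have e : h u + 1 + (h v + 1) = h (u + v) + 1 := by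
      revert hne
      generalize h (u + v) = x
      generalize h u = y
      generalize h v = z
      revert x y z; decide
    rw [e]; exact hh (u + v)
  obtain ⟨a, ha⟩ := additive_eq_dot h hadd
  have hheavy : ∀ u, S.card / 2 + 1 ≤ (side S u (u ⬝ᵥ a)).card := by
    intro u
    have h1 := hh u
    have h2 := side_add S u (h u)
    rw [← ha u]
    obtain ⟨k, hk⟩ := hS
    omega
  have hsum1 : (2 ^ m) * (S.card / 2 + 1) ≤ ∑ u : Fin m → ZMod 2, (side S u (u ⬝ᵥ a)).card := by
    calc (2 ^ m) * (S.card / 2 + 1) = ∑ u : Fin m → ZMod 2, (S.card / 2 + 1) := by simp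
      _ ≤ _ := Finset.sum_le_sum fun u _ => hheavy u
  have hsum2 : ∑ u : Fin m → ZMod 2, (side S u (u ⬝ᵥ a)).card
      = ∑ x ∈ S, (Finset.univ.filter (fun u : Fin m → ZMod 2 => u ⬝ᵥ (x - a) = 0)).card := by
    simp only [side, Finset.card_filter]
    rw [Finset.sum_comm]
    refine Finset.sum_congr rfl fun x _ => Finset.sum_congr rfl fun u _ => ?_
    simp only [dotProduct_sub, sub_eq_zero]
  have hterm : ∀ x ∈ S, 2 * (Finset.univ.filter
      (fun u : Fin m → ZMod 2 => u ⬝ᵥ (x - a) = 0)).card ≤ 2 ^ m + if x = a then 2 ^ m else 0 := by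
    intro x _
    by_cases hx : x = a
    · subst hx
      simp [two_mul]
    · rw [card_dot_zero _ (sub_ne_zero.mpr hx)]
      simp
  have hsum3 : 2 * ∑ u : Fin m → ZMod 2, (side S u (u ⬝ᵥ a)).card
      ≤ S.card * 2 ^ m + 2 ^ m := by
    rw [hsum2, Finset.mul_sum]
    refine (Finset.sum_le_sum hterm).trans ?_
    rw [Finset.sum_add_distrib, Finset.sum_const, smul_eq_mul, Finset.sum_ite_eq']
    split_ifs <;> simp
  obtain ⟨k, hk⟩ := hS
  have hk2 : S.card / 2 = k := by omega
  have hpos : 0 < 2 ^ m := by positivity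
  rw [hk2] at hsum1
  rw [hk] at hsum3
  nlinarith

theorem key2 {m : ℕ} (S : Finset (Fin m → ZMod 2)) (P Q : ℕ → Prop) (hS : Even S.card)
    (hP : ∀ u c, P (side S u c).card)
    (hQ : ∀ u v c d, Q (side (side S u c) v d).card)
    (tie : ∀ a, P a → 2 * a ≠ S.card)
    (tri : ∀ a b c d, a + b + c + d = S.card → P (a + b) → P (a + c) → P (a + d) →
      Q a → 2 * (a + b) < S.card → 2 * (a + c) < S.card → 2 * (a + d) < S.card → False) :
    False := by
  refine key S hS (fun u => tie _ (hP u 0)) ?_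
  intro u v c d h1 h2 h3
  have e1 := side_add (side S u c) v d
  have e2 := side_add (side S u (c + 1)) v d
  have e3 := side_add S u c
  have e4 : (side (side S u c) v d).card + (side (side S u (c + 1)) v d).card
      = (side S v d).card := by
    have := side_add (side S v d) u c
    have c1 : ∀ c, side (side S v d) u c = side (side S u c) v d := by
      intro c; simp only [side]; rw [Finset.filter_comm]
    rw [c1, c1] at this
    exact this
  have e5 : (side (side S u c) v d).card + (side (side S u (c + 1)) v (d + 1)).card
      = (side S (u + v) (c + d)).card := by
    have := side_add (side S (u + v) (c + d)) u c
    have c1 : side (side S (u + v) (c + d)) u c = side (side S u c) v d := by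
      ext x
      simp only [side, Finset.mem_filter, add_dotProduct]
      generalize u ⬝ᵥ x = s
      generalize v ⬝ᵥ x = t
      constructor
      · rintro ⟨⟨hx, h⟩, rfl⟩
        exact ⟨⟨hx, rfl⟩, add_left_cancel h⟩
      · rintro ⟨⟨hx, rfl⟩, rfl⟩
        exact ⟨⟨hx, rfl⟩, rfl⟩
    have c2 : side (side S (u + v) (c + d)) u (c + 1) = side (side S u (c + 1)) v (d + 1) := by
      ext x
      simp only [side, Finset.mem_filter, add_dotProduct]
      generalize u ⬝ᵥ x = s
      generalize v ⬝ᵥ x = t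
      have : s + t = c + d ∧ s = c + 1 ↔ s = c + 1 ∧ t = d + 1 := by
        clear * -
        revert s t c d; decide
      tauto
    rw [c1, c2] at this
    exact this
  refine tri (side (side S u c) v d).card (side (side S u c) v (d + 1)).card
    (side (side S u (c + 1)) v d).card (side (side S u (c + 1)) v (d + 1)).card
    (by omega) ?_ ?_ ?_ (hQ u v c d) (by omega) (by omega) (by omega)
  · rw [e1]; exact hP u c
  · rw [e4]; exact hP v d
  · rw [e5]; exact hP (u + v) (c + d)

/-- `S` is orthogonal to all polynomials of degree at most `r`. -/
def NullSet {m : ℕ} (r : ℕ) (S : Finset (Fin m → ZMod 2)) : Prop :=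
  ∀ p : MvPolynomial (Fin m) (ZMod 2), p.totalDegree ≤ r → ∑ x ∈ S, eval x p = 0

theorem NullSet.side {m r : ℕ} {S : Finset (Fin m → ZMod 2)} (h : NullSet (r + 1) S)
    (u : Fin m → ZMod 2) (c : ZMod 2) : NullSet r (side S u c) := by
  intro p hp
  have hlin : (∑ i, C (u i) * X i + C (c + 1) : MvPolynomial (Fin m) (ZMod 2)).totalDegree ≤ 1 := by
    refine (totalDegree_add _ _).trans (max_le ?_ ((totalDegree_C _).trans_le zero_le_one))
    refine totalDegree_finsetSum_le fun i _ => ?_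
    refine (totalDegree_mul _ _).trans ?_
    simp
  have := h ((∑ i, C (u i) * X i + C (c + 1)) * p)
    ((totalDegree_mul _ _).trans (by omega))
  rw [← this, _root_.side, Finset.sum_filter]
  refine Finset.sum_congr rfl fun x _ => ?_
  have e : eval x (∑ i, C (u i) * X i + C (c + 1)) = u ⬝ᵥ x + (c + 1) := by
    simp [dotProduct]
  rw [eval_mul, e]
  generalize u ⬝ᵥ x = s
  generalize eval x p = t
  clear * -
  revert s c t; decide

theorem NullSet.mono {m r s : ℕ} {S : Finset (Fin m → ZMod 2)} (h : NullSet s S) (hrs : r ≤ s) :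
    NullSet r S := fun p hp => h p (hp.trans hrs)

theorem NullSet.even {m r : ℕ} {S : Finset (Fin m → ZMod 2)} (h : NullSet r S) :
    Even S.card := by
  have := h 1 (by simp)
  simp only [map_one, Finset.sum_const, nsmul_eq_mul, mul_one] at this
  exact (ZMod.natCast_eq_zero_iff_even).mp this

theorem null1 {m : ℕ} {S : Finset (Fin m → ZMod 2)} (h : NullSet 1 S) : S.card ≠ 2 := by
  intro h2
  refine key2 S Even (fun _ => True) h.even (fun u c => (h.side u c).even) (fun _ _ _ _ => trivial)
    ?_ ?_
  · rintro a ⟨k, hk⟩; omega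
  · rintro a b c d h ⟨i, hi⟩ ⟨j, hj⟩ ⟨k, hk⟩; omega

theorem null2 {m : ℕ} {S : Finset (Fin m → ZMod 2)} (h : NullSet 2 S) :
    S.card ≠ 2 ∧ S.card ≠ 4 ∧ S.card ≠ 6 ∧ S.card ≠ 10 := by
  by_contra hcon
  have hc : S.card = 4 ∨ S.card = 6 ∨ S.card = 10 := by
    have := null1 (h.mono one_le_two)
    omega
  refine key2 S (fun n => Even n ∧ n ≠ 2) Even h.even
    (fun u c => ⟨(h.side u c).even, null1 (h.side u c)⟩)
    (fun u v c d => ((h.side u c).side v d).even) ?_ ?_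
  · rintro a ⟨⟨k, hk⟩, h2⟩; omega
  · rintro a b c d h ⟨⟨i, hi⟩, _⟩ ⟨⟨j, hj⟩, _⟩ ⟨⟨k, hk⟩, _⟩ ⟨l, hl⟩; omega

theorem null3 {m : ℕ} {S : Finset (Fin m → ZMod 2)} (h : NullSet 3 S) (hlt : S.card < 28) :
    S.card = 0 ∨ S.card = 16 ∨ S.card = 24 := by
  by_contra hcon
  have hc : S.card = 8 ∨ S.card = 12 ∨ S.card = 14 ∨ S.card = 18 ∨ S.card = 20 ∨ S.card = 22 ∨
      S.card = 26 := by
    have := null2 (h.mono (by norm_num : 2 ≤ 3))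
    obtain ⟨k, hk⟩ := h.even
    omega
  refine key2 S (fun n => Even n ∧ n ≠ 2 ∧ n ≠ 4 ∧ n ≠ 6 ∧ n ≠ 10) (fun n => Even n ∧ n ≠ 2) h.even
    (fun u c => ⟨(h.side u c).even, null2 (h.side u c)⟩)
    (fun u v c d => ⟨((h.side u c).side v d).even, null1 ((h.side u c).side v d)⟩) ?_ ?_
  · rintro a ⟨⟨k, hk⟩, h2⟩; omega
  · rintro a b c d h ⟨⟨i, hi⟩, _⟩ ⟨⟨j, hj⟩, _⟩ ⟨⟨k, hk⟩, _⟩ ⟨⟨l, hl⟩, _⟩ h1 h2 h3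
    clear hcon hlt
    omega

/-! ### Closure properties of `RM` -/

theorem RM_add {r m : ℕ} {f g : (Fin m → ZMod 2) → ZMod 2} (hf : f ∈ RM r m) (hg : g ∈ RM r m) :
    f + g ∈ RM r m := by
  obtain ⟨p, hp, hp'⟩ := hf
  obtain ⟨q, hq, hq'⟩ := hg
  exact ⟨p + q, (totalDegree_add _ _).trans (max_le hp hq), fun x => by simp [hp', hq']⟩

theorem RM_mul {r s m : ℕ} {f g : (Fin m → ZMod 2) → ZMod 2} (hf : f ∈ RM r m) (hg : g ∈ RM s m) :
    f * g ∈ RM (r + s) m := by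
  obtain ⟨p, hp, hp'⟩ := hf
  obtain ⟨q, hq, hq'⟩ := hg
  exact ⟨p * q, (totalDegree_mul _ _).trans (add_le_add hp hq), fun x => by simp [hp', hq']⟩

theorem RM_mono {r s m : ℕ} (h : r ≤ s) {f : (Fin m → ZMod 2) → ZMod 2} (hf : f ∈ RM r m) :
    f ∈ RM s m := by
  obtain ⟨p, hp, hp'⟩ := hf
  exact ⟨p, hp.trans h, hp'⟩

theorem RM_const {r m : ℕ} (c : ZMod 2) : (fun _ => c : (Fin m → ZMod 2) → ZMod 2) ∈ RM r m :=
  ⟨C c, by simp, by simp⟩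

theorem RM_coord {m : ℕ} (i : Fin m) (c : ZMod 2) :
    (fun x => x i + c : (Fin m → ZMod 2) → ZMod 2) ∈ RM 1 m :=
  ⟨X i + C c, (totalDegree_add _ _).trans (by simp), by simp⟩

theorem RM_tail {r m : ℕ} {f : (Fin m → ZMod 2) → ZMod 2} (hf : f ∈ RM r m) :
    (fun x : Fin (m + 1) → ZMod 2 => f (Fin.tail x)) ∈ RM r (m + 1) := by
  obtain ⟨p, hp, hp'⟩ := hf
  refine ⟨rename Fin.succ p, (totalDegree_rename_le _ _).trans hp, fun x => ?_⟩
  rw [eval_rename]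
  exact hp' _

theorem wt_eq {m : ℕ} (f : (Fin m → ZMod 2) → ZMod 2) :
    wt f = (Finset.univ.filter (fun x => f x ≠ 0)).card := by
  rw [wt, Fintype.card_subtype]

theorem wt_compl {m : ℕ} (f : (Fin m → ZMod 2) → ZMod 2) :
    wt f + wt (f + fun _ => 1) = 2 ^ m := by
  rw [wt_eq, wt_eq]
  have h3 := Finset.card_filter_add_card_filter_not (s := (Finset.univ : Finset (Fin m → ZMod 2)))
    (fun x : Fin m → ZMod 2 => f x ≠ 0)
  have h4 : (Finset.univ : Finset (Fin m → ZMod 2)).card = 2 ^ m := by simp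
  rw [h4] at h3
  rw [← h3]
  congr 2
  apply Finset.filter_congr
  intro x _
  simp only [Pi.add_apply]
  generalize f x = t
  revert t; decide

theorem wt_succ {m : ℕ} (f : (Fin (m + 1) → ZMod 2) → ZMod 2) :
    wt f = wt (fun y => f (Fin.cons 0 y)) + wt (fun y => f (Fin.cons 1 y)) := by
  simp only [wt_eq, Finset.card_filter]
  rw [← (Fin.consEquiv (fun _ : Fin (m + 1) => ZMod 2)).sum_comp, Fintype.sum_prod_type]
  exact Fin.sum_univ_two _

theorem spec_compl {r m w : ℕ} (h : w ∈ spec r m) : w ≤ 2 ^ m ∧ 2 ^ m - w ∈ spec r m := by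
  obtain ⟨f, hf, rfl⟩ := h
  have := wt_compl f
  exact ⟨by omega, f + fun _ => 1, RM_add hf (RM_const 1), by omega⟩

theorem spec_add {r m v w : ℕ} (hv : v ∈ spec r m) (hw : w ∈ spec r m) :
    v + w ∈ spec (r + 1) (m + 1) := by
  obtain ⟨f, hf, rfl⟩ := hv
  obtain ⟨g, hg, rfl⟩ := hw
  refine ⟨(fun x => x 0 + 1) * (fun x => f (Fin.tail x)) + (fun x => x 0 + 0) *
    (fun x => g (Fin.tail x)), ?_, ?_⟩
  · rw [add_comm r 1]
    exact RM_add (RM_mul (RM_coord 0 1) (RM_tail hf)) (RM_mul (RM_coord 0 0) (RM_tail hg))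
  · rw [wt_succ]
    have h2 : (1 + 1 : ZMod 2) = 0 := by decide
    simp [h2]

theorem spec_null {m w : ℕ} (hm : 4 ≤ m) (h : w ∈ spec (m - 4) m) :
    ∃ S : Finset (Fin m → ZMod 2), NullSet 3 S ∧ S.card = w := by
  obtain ⟨f, ⟨q, hq, hq'⟩, rfl⟩ := h
  refine ⟨Finset.univ.filter (fun x => f x ≠ 0), ?_, (wt_eq f).symm⟩
  intro p hp
  have hdeg : (q * p).totalDegree < (Fintype.card (ZMod 2) - 1) * Fintype.card (Fin m) := by
    have := totalDegree_mul q p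
    simp only [ZMod.card, Fintype.card_fin]
    omega
  refine Eq.trans ?_ (MvPolynomial.sum_eval_eq_zero _ hdeg)
  rw [Finset.sum_filter]
  refine Finset.sum_congr rfl fun x _ => ?_
  rw [eval_mul, hq']
  generalize f x = s
  generalize eval x p = t
  revert s t; decide

theorem spec_bound {m w : ℕ} (hm : 4 ≤ m) (h : w ∈ spec (m - 4) m) :
    Even w ∧ (w < 28 → w = 0 ∨ w = 16 ∨ w = 24) := by
  obtain ⟨S, hS, rfl⟩ := spec_null hm h
  exact ⟨hS.even, null3 hS⟩

/-! ### Explicit words of `RM(4,8)`: sums of indicator functions of subcubes.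
A subcube is a list of digits, `0` and `1` fixing a coordinate and `2` leaving it free. -/

def cubeF : (m : ℕ) → List ℕ → (Fin m → ZMod 2) → ZMod 2
  | 0, _, _ => 1
  | _ + 1, [], _ => 1
  | m + 1, d :: l, x => (if d = 2 then 1 else x 0 + ((d : ZMod 2) + 1)) * cubeF m l (Fin.tail x)

def cdeg : List ℕ → ℕ
  | [] => 0
  | d :: l => (if d = 2 then 0 else 1) + cdeg l

def restr (b : ℕ) : List (List ℕ) → List (List ℕ)
  | [] => []
  | [] :: L => [] :: restr b L
  | (d :: l) :: L => if d = 2 ∨ d % 2 = b then l :: restr b L else restr b L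

def sumF (m : ℕ) : List (List ℕ) → (Fin m → ZMod 2) → ZMod 2
  | [], _ => 0
  | l :: L, x => cubeF m l x + sumF m L x

def cw : ℕ → List (List ℕ) → ℕ
  | 0, L => L.length % 2
  | m + 1, L => cw m (restr 0 L) + cw m (restr 1 L)

theorem cubeF_mem (m : ℕ) (l : List ℕ) : cubeF m l ∈ RM (cdeg l) m := by
  induction m generalizing l with
  | zero =>
    have : cubeF 0 l = fun _ => 1 := by funext x; simp [cubeF]
    rw [this]; exact RM_const 1
  | succ m ih =>
    cases l with
    | nil =>
      have : cubeF (m + 1) [] = fun _ => 1 := by funext x; simp [cubeF]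
      rw [this]; exact RM_const 1
    | cons d l =>
      have e : cubeF (m + 1) (d :: l) = (fun x => if d = 2 then 1 else x 0 + ((d : ZMod 2) + 1)) *
        (fun x => cubeF m l (Fin.tail x)) := by
        funext x; simp [cubeF]
      rw [e, cdeg]
      refine RM_mul ?_ (RM_tail (ih l))
      by_cases hd : d = 2
      · simp only [hd, if_true]; exact RM_const 1
      · simp only [hd, if_false]; exact RM_coord 0 _

theorem sumF_mem (m r : ℕ) (L : List (List ℕ)) (h : ∀ l ∈ L, cdeg l ≤ r) : sumF m L ∈ RM r m := by
  induction L with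
  | nil =>
    have : sumF m [] = fun _ => 0 := by funext x; simp [sumF]
    rw [this]; exact RM_const 0
  | cons l L ih =>
    have : sumF m (l :: L) = cubeF m l + sumF m L := by funext x; simp [sumF]
    rw [this]
    exact RM_add (RM_mono (h l (by simp)) (cubeF_mem m l)) (ih fun k hk => h k (by simp [hk]))

theorem sumF_cons (m b : ℕ) (hb : b < 2) (L : List (List ℕ)) (y : Fin m → ZMod 2) :
    sumF (m + 1) L (Fin.cons (b : ZMod 2) y) = sumF m (restr b L) y := by
  induction L with
  | nil => simp [sumF, restr]
  | cons l L ih =>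
    cases l with
    | nil =>
      simp only [sumF, restr, ih]
      cases m <;> simp [cubeF]
    | cons d l =>
      simp only [sumF, restr, ih, cubeF, Fin.cons_zero, Fin.tail_cons]
      by_cases hd : d = 2
      · simp [hd, sumF]
      · have hcast : ((d % 2 : ℕ) : ZMod 2) = d := ZMod.natCast_mod d 2
        rw [← hcast]
        have hlt : d % 2 < 2 := Nat.mod_lt _ (by norm_num)
        simp only [hd, if_false, false_or]
        generalize d % 2 = e at *
        have h2 : (1 + 1 : ZMod 2) = 0 := by decide
        interval_cases e <;> interval_cases b <;> simp [sumF, h2]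

theorem wt_sumF (m : ℕ) (L : List (List ℕ)) : wt (sumF m L) = cw m L := by
  induction m generalizing L with
  | zero =>
    have h1 : ∀ x, sumF 0 L x = (L.length : ZMod 2) := by
      intro x
      induction L with
      | nil => simp [sumF]
      | cons l L ih => simp [sumF, cubeF, ih, add_comm]
    have h2 : sumF 0 L = fun _ => ((L.length % 2 : ℕ) : ZMod 2) := by
      funext x; rw [h1, ZMod.natCast_mod]
    rw [h2, cw, wt_eq]
    have hlt : L.length % 2 < 2 := Nat.mod_lt _ (by norm_num)
    generalize L.length % 2 = e at *
    interval_cases e <;> simp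
  | succ m ih =>
    rw [wt_succ, cw, ← ih, ← ih]
    congr 2
    · funext y
      simpa using sumF_cons m 0 (by norm_num) L y
    · funext y
      simpa using sumF_cons m 1 (by norm_num) L y

/-- Words of weight `28, 30, ..., 128`. -/
def table : List (List (List ℕ)) := [
  [[2,0,0,0,2,2,2,1], [0,2,0,2,1,2,1,2]],
  [[2,2,1,2,1,1,0,2], [1,1,2,1,2,2,2,1]],
  [[0,0,0,2,2,2,2,2]],
  [[0,2,2,0,2,1,2,1], [2,2,0,0,1,1,2,2], [2,1,0,2,1,2,0,2]],
  [[1,1,2,2,1,2,0,2], [2,1,2,2,1,2,2,1], [2,1,0,1,2,2,2,1]],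
  [[2,1,2,2,1,1,0,2], [0,2,2,2,0,0,2,1], [0,2,0,1,2,2,2,1]],
  [[1,0,2,2,1,2,1,2], [2,2,0,2,2,2,1,1]],
  [[0,2,1,2,0,0,2,2], [2,1,2,0,2,2,1,1], [0,2,0,2,1,2,2,1]],
  [[2,0,2,0,2,0,2,2], [1,2,1,2,2,2,1,0]],
  [[2,2,0,0,2,1,1,2], [0,2,2,2,1,0,2,0], [2,0,1,0,2,2,0,2]],
  [[0,2,0,0,2,2,2,0], [2,2,2,2,0,2,0,1]],
  [[0,2,2,1,2,0,0,2], [0,2,2,1,2,2,1,1], [2,0,2,1,2,1,1,2], [2,0,1,2,0,2,2,0]],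
  [[1,0,2,1,2,2,2,1], [2,0,0,2,0,1,2,2], [2,2,0,0,2,2,2,0]],
  [[0,2,2,0,2,2,1,1], [2,1,1,2,0,0,2,2], [2,1,2,0,1,2,2,2]],
  [[1,2,2,0,2,0,2,2], [2,2,1,2,1,2,2,0]],
  [[2,1,2,2,2,0,1,2], [2,1,2,2,2,1,0,1], [0,2,1,0,0,2,2,2]],
  [[2,1,1,0,2,2,2,2], [2,0,2,1,2,2,1,0], [0,2,0,2,0,2,1,2]],
  [[0,2,1,2,2,1,2,0], [2,2,2,2,2,0,0,0], [2,1,2,0,1,2,1,2]],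
  [[2,0,2,2,2,2,1,2]],
  [[2,1,2,1,1,2,1,2], [1,2,0,2,2,1,2,1], [2,1,2,2,2,1,2,2]],
  [[2,2,2,0,1,1,1,2], [1,2,1,2,1,2,2,1], [2,2,2,2,2,2,1,1]],
  [[2,2,0,2,2,1,2,0], [1,2,1,2,0,2,2,1], [2,0,2,1,2,0,0,2], [0,1,2,2,1,2,2,0]],
  [[1,2,2,2,2,1,2,2], [2,2,2,1,0,2,0,0]],
  [[2,1,2,2,0,1,2,0], [2,0,2,2,2,1,2,0], [0,2,1,1,1,2,2,2], [2,1,2,2,2,0,0,1]],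
  [[2,2,2,2,0,1,0,2], [2,2,2,2,0,0,2,1], [0,0,2,0,2,2,1,2]],
  [[0,2,2,2,2,2,1,2], [2,0,0,2,2,2,1,1], [1,2,2,0,1,0,2,2]],
  [[0,1,2,2,2,0,1,2], [1,1,2,2,2,2,2,2]],
  [[2,2,2,2,0,2,1,2], [2,0,2,2,1,2,0,2], [0,0,2,1,2,1,2,2], [2,2,1,2,0,2,1,0]],
  [[2,2,2,2,1,0,0,0], [0,1,2,2,2,2,2,2], [0,0,2,0,2,2,0,2]],
  [[1,1,2,1,0,2,2,2], [2,2,1,2,2,1,0,1], [2,2,1,2,2,0,2,2]],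
  [[2,2,1,1,2,0,2,1], [2,2,2,2,0,1,2,2], [1,2,2,1,2,0,0,2]],
  [[2,1,0,2,2,2,0,0], [1,1,2,0,2,1,2,2], [2,2,2,2,2,0,0,2], [2,2,1,2,1,2,1,0]],
  [[2,2,2,2,0,2,1,1], [0,0,0,1,2,2,2,2], [2,2,1,1,2,2,2,2]],
  [[2,0,2,0,1,2,2,1], [2,2,0,1,2,2,2,2], [0,2,1,2,2,1,1,2]],
  [[2,2,1,2,2,2,2,1], [2,0,2,2,2,2,0,2]],
  [[1,0,1,2,2,2,2,1], [2,2,2,1,0,0,1,2], [1,2,2,1,2,2,2,2], [0,2,2,2,2,2,0,0]],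
  [[1,2,2,0,2,2,2,2], [1,2,2,1,1,2,2,2], [2,1,0,2,2,0,0,2]],
  [[0,0,1,2,2,2,1,2], [0,0,2,1,2,1,2,2], [2,1,2,2,2,0,2,2], [2,2,2,0,0,1,2,0]],
  [[2,2,2,0,1,2,2,2], [0,2,1,2,2,2,2,2], [2,1,2,1,1,1,2,2]],
  [[1,2,0,1,0,2,2,2], [2,1,0,1,1,2,2,2], [2,1,2,2,2,0,1,0], [2,2,2,2,0,1,2,2], [2,2,0,0,2,2,2,1]],
  [[2,2,1,2,2,0,2,2], [0,0,2,2,2,1,2,0], [2,2,0,1,0,2,2,2]],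
  [[1,2,2,1,1,2,0,2], [1,2,2,0,2,2,2,2], [2,2,2,1,2,1,1,1], [0,0,1,2,1,2,2,2]],
  [[0,2,0,0,2,1,2,2], [2,2,1,2,0,2,2,2], [0,2,0,1,2,2,2,2]],
  [[2,2,2,2,2,2,0,1], [2,1,2,2,1,2,2,2], [2,2,0,2,0,2,0,2], [2,0,2,2,1,2,1,0], [0,2,0,1,2,1,2,2]],
  [[2,0,0,2,2,1,0,2], [1,2,2,2,1,2,2,1], [1,2,2,2,0,0,2,0], [0,2,2,0,2,2,2,2]],
  [[0,2,2,1,1,2,0,2], [2,2,1,2,1,2,1,2], [2,2,0,0,2,2,2,2], [2,1,1,2,2,0,2,1]],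
  [[1,2,1,0,2,2,2,1], [1,2,2,2,2,1,2,2], [2,0,2,2,2,0,2,2]],
  [[0,2,2,2,2,0,1,2], [2,2,2,2,2,1,2,1], [2,1,0,2,2,2,0,2], [2,2,1,0,1,2,2,0], [0,0,2,2,2,1,0,2]],
  [[2,1,2,2,2,2,0,2], [1,2,2,2,2,0,2,2], [2,0,1,2,2,2,2,1], [2,2,2,1,1,2,1,2]],
  [[1,2,0,0,2,2,1,2], [2,2,2,1,0,2,2,2], [1,0,0,2,2,1,2,2], [0,2,2,2,2,2,2,0], [2,2,2,1,1,2,0,1]],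
  [[2,2,2,2,1,2,2,0], [2,1,2,2,0,2,2,2]]]

theorem table_ok : table.map (cw 8) = (List.range 51).map (fun i => 28 + 2 * i) := by
  decide +kernel

theorem table_deg : ∀ L ∈ table, ∀ l ∈ L, cdeg l ≤ 4 := by
  decide +kernel

theorem base_low {w : ℕ} (he : Even w) (h1 : 28 ≤ w) (h2 : w ≤ 128) : w ∈ spec 4 8 := by
  have hw : w ∈ table.map (cw 8) := by
    rw [table_ok, List.mem_map]
    obtain ⟨k, hk⟩ := he
    exact ⟨k - 14, by rw [List.mem_range]; omega, by omega⟩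
  obtain ⟨L, hL, rfl⟩ := List.mem_map.mp hw
  exact ⟨sumF 8 L, sumF_mem 8 4 L (table_deg L hL), wt_sumF 8 L⟩

theorem spec_of_cubes {w : ℕ} (L : List (List ℕ)) (h : ∀ l ∈ L, cdeg l ≤ 4) (hw : cw 8 L = w) :
    w ∈ spec 4 8 := ⟨sumF 8 L, sumF_mem 8 4 L h, by rw [wt_sumF, hw]⟩

theorem base_small : 0 ∈ spec 4 8 ∧ 16 ∈ spec 4 8 ∧ 24 ∈ spec 4 8 := by
  refine ⟨spec_of_cubes [] ?_ ?_, spec_of_cubes [[1,1,1,1,2,2,2,2]] ?_ ?_,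
    spec_of_cubes [[1,1,1,1,2,2,2,2], [1,1,2,2,1,1,2,2]] ?_ ?_⟩ <;> decide +kernel

theorem spec_lower (n : ℕ) : 0 ∈ spec (n + 4) (n + 8) ∧ 16 ∈ spec (n + 4) (n + 8) ∧
    24 ∈ spec (n + 4) (n + 8) ∧
    ∀ w, Even w → 28 ≤ w → w ≤ 2 ^ (n + 8) - 28 → w ∈ spec (n + 4) (n + 8) := by
  induction n with
  | zero =>
    refine ⟨base_small.1, base_small.2.1, base_small.2.2, fun w he h1 h2 => ?_⟩
    norm_num at h2 ⊢
    by_cases h : w ≤ 128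
    · exact base_low he h1 h
    · have h3 : 256 - w ∈ spec 4 8 := by
        refine base_low ?_ (by omega) (by omega)
        obtain ⟨k, hk⟩ := he
        exact ⟨128 - k, by omega⟩
      have h4 := (spec_compl h3).2
      norm_num at h4
      rwa [show 256 - (256 - w) = w by omega] at h4
  | succ n ih =>
    obtain ⟨i0, i16, i24, ih⟩ := ih
    rw [show n + 1 + 4 = (n + 4) + 1 by ring, show n + 1 + 8 = (n + 8) + 1 by ring]
    have hpow : 2 ^ (n + 8 + 1) = 2 * 2 ^ (n + 8) := by ring
    have hbig : 256 ≤ 2 ^ (n + 8) := by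
      calc 256 = 2 ^ 8 := by norm_num
        _ ≤ 2 ^ (n + 8) := Nat.pow_le_pow_right (by norm_num) (by omega)
    have hev : Even (2 ^ (n + 8)) := ⟨2 ^ (n + 7), by ring⟩
    have low : ∀ w, w ∈ spec (n + 4) (n + 8) → w ∈ spec (n + 4 + 1) (n + 8 + 1) := by
      intro w hw
      simpa using spec_add i0 hw
    refine ⟨low _ i0, low _ i16, low _ i24, fun w he h1 h2 => ?_⟩
    rw [hpow] at h2
    have half : ∀ v, Even v → 28 ≤ v → v ≤ 2 ^ (n + 8) → v ∈ spec (n + 4 + 1) (n + 8 + 1) := by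
      intro v hv hv1 hv2
      by_cases h : v ≤ 2 ^ (n + 8) - 28
      · exact low v (ih v hv hv1 h)
      · have h28 := ih 28 (by decide) le_rfl (by omega)
        have hr := ih (v - 28) (by
          obtain ⟨k, hk⟩ := hv
          exact ⟨k - 14, by omega⟩) (by omega) (by omega)
        have := spec_add h28 hr
        rwa [show 28 + (v - 28) = v by omega] at this
    by_cases h : w ≤ 2 ^ (n + 8)
    · exact half w he h1 h
    · have hr := half (2 * 2 ^ (n + 8) - w) (by
          obtain ⟨k, hk⟩ := he
          exact ⟨2 ^ (n + 8) - k, by omega⟩) (by omega) (by omega)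
      have := (spec_compl hr).2
      rwa [hpow, show 2 * 2 ^ (n + 8) - (2 * 2 ^ (n + 8) - w) = w by omega] at this

theorem spec_RM_m_sub_4 (m : ℕ) (hm : 8 ≤ m) :
    spec (m - 4) m =
      ({0, 16, 24} : Set ℕ) ∪ {w | Even w ∧ 28 ≤ w ∧ w ≤ 2 ^ m - 28} ∪
        {2 ^ m - 24, 2 ^ m - 16, 2 ^ m} := by
  have hbig : 256 ≤ 2 ^ m := by
    calc 256 = 2 ^ 8 := by norm_num
      _ ≤ 2 ^ m := Nat.pow_le_pow_right (by norm_num) hm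
  ext w
  simp only [Set.mem_union, Set.mem_insert_iff, Set.mem_singleton_iff, Set.mem_ofPred_eq]
  constructor
  · intro hw
    obtain ⟨he, hs⟩ := spec_bound (by omega) hw
    obtain ⟨hle, hc⟩ := spec_compl hw
    obtain ⟨_, hs'⟩ := spec_bound (by omega) hc
    by_cases h1 : w < 28
    · left; left; exact hs h1
    · by_cases h2 : 2 ^ m - w < 28
      · right
        have := hs' h2
        omega
      · left; right
        exact ⟨he, by omega, by omega⟩
  · obtain ⟨n, rfl⟩ : ∃ n, m = n + 8 := ⟨m - 8, by omega⟩
    obtain ⟨i0, i16, i24, ih⟩ := spec_lower n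
    rw [show n + 8 - 4 = n + 4 by omega]
    rintro (((rfl | rfl | rfl) | ⟨he, h1, h2⟩) | (rfl | rfl | rfl))
    · exact i0
    · exact i16
    · exact i24
    · exact ih w he h1 h2
    · exact (spec_compl i24).2
    · exact (spec_compl i16).2
    · exact (spec_compl i0).2
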